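/- The six vectors (η₁(v), η₂(v), η₃(v), η₄(v), η₅(v), η₆(v)) ∈ ℚ⁶, as v ranges over vJ⁺(0,1), vJᴬ(0,0), vJᴬ(1,1), vJ⁺(0,0), vJ⁺(1,1), vJᴬ(0,1), form a basis of ℚ⁶. -/

import Mathlib

noncomputable section

abbrev Xsp : Type := (ℤ × ℤ) →₀ ℚ
abbrev Ysp : Type := ℤ →₀ ℚ
abbrev V : Type := Xsp × Ysp

/-- The basis vector `X_{a,b}` of `V`. -/
def XB (a b : ℤ) : V := (Finsupp.single (a, b) 1, 0)

/-- The basis vector `Y_d` of `V`. -/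
def YB (d : ℤ) : V := (0, Finsupp.single d 1)

/-- The linear map `V → ℚ` determined on the basis by `X_{a,b} ↦ gX (a,b)`, `Y_d ↦ gY d`. -/
def lmap (gX : ℤ × ℤ → ℚ) (gY : ℤ → ℚ) : V →ₗ[ℚ] ℚ :=
  (Finsupp.linearCombination ℚ gX).comp (LinearMap.fst ℚ Xsp Ysp)
  + (Finsupp.linearCombination ℚ gY).comp (LinearMap.snd ℚ Xsp Ysp)

/-- `η₁ : X_{a,b} ↦ (a+b)²` for `a+b` odd, `Y_d ↦ -d²` for `d` odd, all else to `0`. -/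
def eta1 : V →ₗ[ℚ] ℚ :=
  lmap (fun p => if Odd (p.1 + p.2) then ((p.1 : ℚ) + p.2) ^ 2 else 0)
    (fun d => if Odd d then -(d : ℚ) ^ 2 else 0)

/-- `η₂ : X_{a,b} ↦ (a+b)²` for `a+b` even, `Y_d ↦ -d²` for `d` even, all else to `0`. -/
def eta2 : V →ₗ[ℚ] ℚ :=
  lmap (fun p => if Even (p.1 + p.2) then ((p.1 : ℚ) + p.2) ^ 2 else 0)
    (fun d => if Even d then -(d : ℚ) ^ 2 else 0)

/-- `η₃ : X_{a,b} ↦ 1` for `a` even, `b` odd, all else to `0`. -/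
def eta3 : V →ₗ[ℚ] ℚ :=
  lmap (fun p => if Even p.1 ∧ Odd p.2 then 1 else 0) (fun _ => 0)

/-- `η₄ : X_{a,b} ↦ 1` for `a` even, `b` even, all else to `0`. -/
def eta4 : V →ₗ[ℚ] ℚ :=
  lmap (fun p => if Even p.1 ∧ Even p.2 then 1 else 0) (fun _ => 0)

/-- `η₅ : X_{a,b} ↦ 1` for `a` odd, `b` even, all else to `0`. -/
def eta5 : V →ₗ[ℚ] ℚ :=
  lmap (fun p => if Odd p.1 ∧ Even p.2 then 1 else 0) (fun _ => 0)

/-- `η₆ : X_{a,b} ↦ 1` for `a` odd, `b` odd, all else to `0`. -/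
def eta6 : V →ₗ[ℚ] ℚ :=
  lmap (fun p => if Odd p.1 ∧ Odd p.2 then 1 else 0) (fun _ => 0)

/-- The six linear maps `η₁, …, η₆`. -/
def eta : Fin 6 → (V →ₗ[ℚ] ℚ) := ![eta1, eta2, eta3, eta4, eta5, eta6]

/-- `vJ⁺(a,b) = X_{a,b} + X_{b,a} + 2·Y_{a+b}`, the value `F⁽¹⁾(J⁺_{a,b})`. -/
def vJp (a b : ℤ) : V := XB a b + XB b a + (2 : ℚ) • YB (a + b)

/-- `vJᴬ(a,b) = X_{a,b+1} + X_{b,a+1} + Y_{a+b-1} + Y_{a+b+3}`, the value `F⁽¹⁾(J^A_{a,b})`. -/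
def vJA (a b : ℤ) : V := XB a (b + 1) + XB b (a + 1) + YB (a + b - 1) + YB (a + b + 3)

/-- The six vectors of values `(η₁(v), …, η₆(v)) ∈ ℚ⁶` for
`v = vJ⁺(0,1), vJᴬ(0,0), vJᴬ(1,1), vJ⁺(0,0), vJ⁺(1,1), vJᴬ(0,1)`. -/
def etaVec : Fin 6 → (Fin 6 → ℚ) := fun j i =>
  eta i (![vJp 0 1, vJA 0 0, vJA 1 1, vJp 0 0, vJp 1 1, vJA 0 1] j)

@[simp]
lemma lmap_XB (gX : ℤ × ℤ → ℚ) (gY : ℤ → ℚ) (a b : ℤ) : lmap gX gY (XB a b) = gX (a, b) := by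
  simp [lmap, XB]

@[simp]
lemma lmap_YB (gX : ℤ × ℤ → ℚ) (gY : ℤ → ℚ) (d : ℤ) : lmap gX gY (YB d) = gY d := by
  simp [lmap, YB]

/-- The explicit matrix of values `ηᵢ(v)`. -/
lemma etaVec_eq : etaVec =
    ![![0, 0, 1, 0, 1, 0], ![-8, 0, 2, 0, 0, 0], ![-8, 0, 0, 0, 2, 0],
      ![0, 0, 0, 2, 0, 0], ![0, 0, 0, 0, 0, 2], ![0, -8, 0, 1, 0, 1]] := by
  ext j i
  fin_cases j <;> fin_cases i <;>
    norm_num [etaVec, eta, eta1, eta2, eta3, eta4, eta5, eta6, vJp, vJA, Int.odd_iff, Int.even_iff]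

lemma linearIndependent_etaVec : LinearIndependent ℚ etaVec := by
  rw [etaVec_eq, Fintype.linearIndependent_iff]
  intro g hg
  have h (i : Fin 6) := congrFun hg i
  simp only [Fin.forall_fin_succ, Fin.sum_univ_succ] at h
  simp at h
  obtain ⟨h1, h2, h3, h4, h5, h6⟩ := h
  intro i
  fin_cases i <;> simp <;> linarith

theorem stmt16 :
    LinearIndependent ℚ etaVec ∧ Submodule.span ℚ (Set.range etaVec) = ⊤ :=
  ⟨linearIndependent_etaVec,
    linearIndependent_etaVec.span_eq_top_of_card_eq_finrank (by simp)⟩
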